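/- For any ψ ∈ 𝒩_log and p ≥ 1, the lifting operator Π f(h,v) = f(h) is an isometry from L^p(ℝ^n, μ̃) into L^p(G, 𝗉_ψ), and for all f ∈ L^p(ℝ^n, μ̃) and t ≥ 0, ℙ^ψ_t Π f = Π P̃_t f, where P̃ is the Ornstein–Uhlenbeck semigroup on ℝ^n generated by L̃ = Δ − ⟨h,∇⟩. -/

import Mathlib

/-!
STATEMENT 11:
For any `ψ = (σ,b,κ) ∈ 𝒩_log` and `p ≥ 1`, the lifting operator `Π f(h,v) = f(h)` is an
isometry from `L^p(ℝ^n, μ̃)` into `L^p(G, 𝗉_ψ)` (`μ̃` the standard Gaussian measure on `ℝ^n`,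
`𝗉_ψ` the invariant density of the Lévy–OU semigroup `ℙ^ψ`), and for all `f` and `t ≥ 0`,
`ℙ^ψ_t Π f = Π P̃_t f`, where `P̃` is the Ornstein–Uhlenbeck semigroup on `ℝ^n` generated by
`L̃ = Δ − ⟨h,∇⟩`, i.e. `P̃_t f(x) = ∫ f(e^{-t}x + √(1−e^{-2t}) y) μ̃(dy)` (Mehler formula).

`ℙ^ψ` is realized through its explicit formula
`ℙ^ψ_t f(h,v) = ∫ Q_{(1−e^{-2t})/2} f(δ_{e^{-t}}(h, v−u)) μ^{ψ_t}(du)`, where `Q` is the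
horizontal heat semigroup of `G` (given by its heat kernel `𝗊`) and `μ^{ψ_t}` has
characteristic function `e^{ψ_t}`; `𝗉_ψ = 𝗊_{1/2} *_v μ̄_ψ`.
-/

open MeasureTheory Complex

noncomputable section

abbrev Gr (n m : ℕ) := (Fin n → ℝ) × (Fin m → ℝ)

def grpMul {n m : ℕ} (ω : (Fin n → ℝ) →ₗ[ℝ] (Fin n → ℝ) →ₗ[ℝ] (Fin m → ℝ))
    (g g' : Gr n m) : Gr n m :=
  (g.1 + g'.1, g.2 + g'.2 + (2⁻¹ : ℝ) • ω g.1 g'.1)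

def grpInv {n m : ℕ} (g : Gr n m) : Gr n m := (-g.1, -g.2)

def dil {n m : ℕ} (c : ℝ) (g : Gr n m) : Gr n m := (c • g.1, (c ^ 2) • g.2)

def Zdir {n m : ℕ} (ω : (Fin n → ℝ) →ₗ[ℝ] (Fin n → ℝ) →ₗ[ℝ] (Fin m → ℝ))
    (i : Fin n) (g : Gr n m) : (Fin n → ℝ) × (Fin m → ℝ) :=
  (Pi.single i 1, (2⁻¹ : ℝ) • ω g.1 (Pi.single i 1))

def Zderiv {n m : ℕ} (ω : (Fin n → ℝ) →ₗ[ℝ] (Fin n → ℝ) →ₗ[ℝ] (Fin m → ℝ))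
    (i : Fin n) (f : Gr n m → ℂ) (g : Gr n m) : ℂ :=
  fderiv ℝ f g (Zdir ω i g)

def subLap {n m : ℕ} (ω : (Fin n → ℝ) →ₗ[ℝ] (Fin n → ℝ) →ₗ[ℝ] (Fin m → ℝ))
    (f : Gr n m → ℂ) (g : Gr n m) : ℂ :=
  ∑ i : Fin n, Zderiv ω i (fun x => Zderiv ω i f x) g

def dotR {p : ℕ} (x y : Fin p → ℝ) : ℝ := ∑ i, x i * y i

def levyExp {m : ℕ} (σM : Matrix (Fin m) (Fin m) ℝ) (b : Fin m → ℝ)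
    (κ : Measure (Fin m → ℝ)) (l : Fin m → ℝ) : ℂ :=
  -((dotR (σM.mulVec l) l : ℝ) : ℂ) + Complex.I * ((dotR b l : ℝ) : ℂ) +
    ∫ v, (Complex.exp (Complex.I * ((dotR v l : ℝ) : ℂ)) - 1 -
      (if ‖v‖ ≤ 1 then Complex.I * ((dotR v l : ℝ) : ℂ) else 0)) ∂κ

def IsLevyTriple {m : ℕ} (σM : Matrix (Fin m) (Fin m) ℝ) (b : Fin m → ℝ)
    (κ : Measure (Fin m → ℝ)) : Prop :=
  σM.PosSemidef ∧ κ {0} = 0 ∧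
    (∫⁻ v, ENNReal.ofReal (min 1 (‖v‖ ^ 2)) ∂κ) < ⊤

def HasLogMoment {m : ℕ} (κ : Measure (Fin m → ℝ)) : Prop :=
  (∫⁻ v in {v : Fin m → ℝ | 1 < ‖v‖}, ENNReal.ofReal (Real.log ‖v‖) ∂κ) < ⊤

def psit {m : ℕ} (σM : Matrix (Fin m) (Fin m) ℝ) (b : Fin m → ℝ)
    (κ : Measure (Fin m → ℝ)) (t : ℝ) (l : Fin m → ℝ) : ℂ :=
  ∫ s in (0 : ℝ)..t, levyExp σM b κ (fun i => Real.exp (2 * s) * l i)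

def psiInfty {m : ℕ} (σM : Matrix (Fin m) (Fin m) ℝ) (b : Fin m → ℝ)
    (κ : Measure (Fin m → ℝ)) (l : Fin m → ℝ) : ℂ :=
  ∫ s in Set.Ioi (0 : ℝ), levyExp σM b κ (fun i => Real.exp (-(2 * s)) * l i)

/-- The horizontal heat semigroup, acting on functions via its heat kernel `𝗊_t`. -/
def Qhf {n m : ℕ} (ω : (Fin n → ℝ) →ₗ[ℝ] (Fin n → ℝ) →ₗ[ℝ] (Fin m → ℝ))
    (qheat : ℝ → Gr n m → ℝ) (t : ℝ) (f : Gr n m → ℂ) (g : Gr n m) : ℂ :=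
  if t ≤ 0 then f g
  else ∫ g' : Gr n m, ((qheat t (grpMul ω (grpInv g) g') : ℝ) : ℂ) * f g'

/-- The Lévy–OU semigroup `ℙ^ψ_t f(h,v) = ∫ Q_{(1−e^{-2t})/2} f(δ_{e^{-t}}(h,v−u)) μ^{ψ_t}(du)`. -/
def POUpsi {n m : ℕ} (ω : (Fin n → ℝ) →ₗ[ℝ] (Fin n → ℝ) →ₗ[ℝ] (Fin m → ℝ))
    (qheat : ℝ → Gr n m → ℝ) (μψ : ℝ → Measure (Fin m → ℝ))
    (t : ℝ) (f : Gr n m → ℂ) (g : Gr n m) : ℂ :=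
  ∫ u, Qhf ω qheat ((1 - Real.exp (-(2 * t))) / 2) f
    (dil (Real.exp (-t)) ((g.1, g.2 - u) : Gr n m)) ∂(μψ t)

/-- The standard Gaussian density `(2π)^{-n/2} e^{-|h|²/2}` on `ℝ^n`. -/
def gaussDen {n : ℕ} (h : Fin n → ℝ) : ℝ :=
  (Real.sqrt ((2 * Real.pi) ^ n))⁻¹ * Real.exp (-(∑ i, (h i) ^ 2) / 2)

/-- The OU semigroup on `ℝ^n` with generator `L̃ = Δ − ⟨x,∇⟩` (Mehler's formula):
`P̃_t f(x) = ∫ f(e^{-t}x + √(1−e^{-2t}) y) μ̃(dy)`. -/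
def OUreal {n : ℕ} (t : ℝ) (f : (Fin n → ℝ) → ℂ) (x : Fin n → ℝ) : ℂ :=
  ∫ y : Fin n → ℝ,
    f (Real.exp (-t) • x + Real.sqrt (1 - Real.exp (-(2 * t))) • y) * ((gaussDen y : ℝ) : ℂ)

section Helpers

open Filter Topology ProbabilityTheory

variable {n m : ℕ}

lemma continuous_bilin (ω : (Fin n → ℝ) →ₗ[ℝ] (Fin n → ℝ) →ₗ[ℝ] (Fin m → ℝ)) :
    Continuous fun p : (Fin n → ℝ) × (Fin n → ℝ) => ω p.1 p.2 := by
  have h := ω.toContinuousBilinearMap.continuous₂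
  exact h

lemma continuous_grpMul_inv (ω : (Fin n → ℝ) →ₗ[ℝ] (Fin n → ℝ) →ₗ[ℝ] (Fin m → ℝ)) :
    Continuous fun p : Gr n m × Gr n m => grpMul ω (grpInv p.1) p.2 := by
  have h : Continuous fun p : Gr n m × Gr n m => ω (-p.1.1) p.2.1 :=
    (continuous_bilin ω).comp (f := fun p : Gr n m × Gr n m => (-p.1.1, p.2.1)) (by fun_prop)
  unfold grpMul grpInv
  fun_prop

/-- Lebesgue measure is left invariant on a step-two group. -/
lemma measurePreserving_grpMul (ω : (Fin n → ℝ) →ₗ[ℝ] (Fin n → ℝ) →ₗ[ℝ] (Fin m → ℝ))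
    (g : Gr n m) : MeasurePreserving (fun x : Gr n m => grpMul ω g x) volume volume := by
  have hc : Continuous fun p : (Fin n → ℝ) × (Fin m → ℝ) => ω g.1 p.1 :=
    (continuous_bilin ω).comp
      (f := fun p : (Fin n → ℝ) × (Fin m → ℝ) => (g.1, p.1)) (by fun_prop)
  refine (measurePreserving_add_left (volume : Measure (Fin n → ℝ)) g.1).skew_product
    (g := fun x v => g.2 + v + (2⁻¹ : ℝ) • ω g.1 x) ?_ (ae_of_all _ fun x => ?_)
  · exact Continuous.measurable (by unfold Function.uncurry; fun_prop)
  · have : (fun v : Fin m → ℝ => g.2 + v + (2⁻¹ : ℝ) • ω g.1 x)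
        = fun v => (g.2 + (2⁻¹ : ℝ) • ω g.1 x) + v := by
      ext v i; simp; ring
    rw [this]
    exact map_add_left_eq_self _ _

lemma measurePreserving_shear (ω : (Fin n → ℝ) →ₗ[ℝ] (Fin n → ℝ) →ₗ[ℝ] (Fin m → ℝ)) :
    MeasurePreserving (fun p : Gr n m × Gr n m => (p.1, grpMul ω (grpInv p.1) p.2))
      (volume.prod volume) (volume.prod volume) :=
  (MeasurePreserving.id volume).skew_product (g := fun g x => grpMul ω (grpInv g) x)
    (continuous_grpMul_inv ω).measurable
    (ae_of_all _ fun g => (measurePreserving_grpMul ω (grpInv g)).map_eq)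

/-- The horizontal character `(h, v) ↦ e^{i L(h)}`. -/
def horChar (L : StrongDual ℝ (Fin n → ℝ)) (g : Gr n m) : ℂ := Complex.exp ((L g.1 : ℂ) * I)

lemma contDiff_horChar (L : StrongDual ℝ (Fin n → ℝ)) :
    ContDiff ℝ (⊤ : ℕ∞) (horChar L : Gr n m → ℂ) := by
  unfold horChar
  have : ContDiff ℝ (⊤ : ℕ∞) fun g : Gr n m => ((L g.1 : ℝ) : ℂ) :=
    ofRealCLM.contDiff.comp (L.contDiff.comp contDiff_fst)
  fun_prop

lemma norm_horChar (L : StrongDual ℝ (Fin n → ℝ)) (g : Gr n m) : ‖horChar L g‖ = 1 :=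
  norm_exp_ofReal_mul_I _

lemma horChar_mul_grpMul_inv (ω : (Fin n → ℝ) →ₗ[ℝ] (Fin n → ℝ) →ₗ[ℝ] (Fin m → ℝ))
    (L : StrongDual ℝ (Fin n → ℝ)) (g g' : Gr n m) :
    horChar L g * horChar L (grpMul ω (grpInv g) g') = horChar L g' := by
  simp only [horChar, grpMul, grpInv, ← Complex.exp_add, map_add, map_neg]
  congr 1
  push_cast
  ring

lemma Zderiv_horChar (ω : (Fin n → ℝ) →ₗ[ℝ] (Fin n → ℝ) →ₗ[ℝ] (Fin m → ℝ))
    (L : StrongDual ℝ (Fin n → ℝ)) (i : Fin n) (c : ℂ) (g : Gr n m) :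
    Zderiv ω i (fun g => c * horChar L g) g = c * (L (Pi.single i 1) * I) * horChar L g := by
  have h1 : HasFDerivAt (fun g : Gr n m => ((L g.1 : ℝ) : ℂ))
      (ofRealCLM.comp (L.comp (ContinuousLinearMap.fst ℝ _ _))) g :=
    (ofRealCLM.comp (L.comp (ContinuousLinearMap.fst ℝ (Fin n → ℝ) (Fin m → ℝ)))).hasFDerivAt
  have h2 := ((h1.mul_const I).cexp).const_mul c
  rw [Zderiv]
  unfold horChar
  rw [h2.fderiv]
  simp [Zdir]
  ring

/-- Localised horizontal characters have the expected sub-Laplacian at the identity. -/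
lemma subLap_horChar_mul_cutoff (ω : (Fin n → ℝ) →ₗ[ℝ] (Fin n → ℝ) →ₗ[ℝ] (Fin m → ℝ))
    (L : StrongDual ℝ (Fin n → ℝ)) (χ : Gr n m → ℂ) (hχ : ∀ᶠ g in 𝓝 0, χ g = 1) :
    subLap ω (fun g => horChar L g * χ g) 0 = -((∑ i, L (Pi.single i 1) ^ 2 : ℝ) : ℂ) := by
  have h0 : (fun g => horChar L g * χ g) =ᶠ[𝓝 0] fun g : Gr n m => 1 * horChar L g := by
    filter_upwards [hχ] with g hg
    simp [hg]
  unfold subLap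
  push_cast
  rw [← Finset.sum_neg_distrib]
  refine Finset.sum_congr rfl fun i _ => ?_
  have h1 : (fun x => Zderiv ω i (fun g => horChar L g * χ g) x)
      =ᶠ[𝓝 0] fun g => (1 * (L (Pi.single i 1) * I)) * horChar L g := by
    filter_upwards [h0.fderiv (𝕜 := ℝ)] with g hg
    rw [← Zderiv_horChar ω L i 1 g, Zderiv, Zderiv, hg]
  rw [Zderiv, h1.fderiv_eq, ← Zderiv, Zderiv_horChar]
  simp only [horChar, Prod.fst_zero, map_zero, ofReal_zero, zero_mul, Complex.exp_zero]
  linear_combination (L (Pi.single i 1) : ℂ) ^ 2 * I_sq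

/-- The characteristic function of the horizontal marginal of the density `q`. -/
def horFourier (q : Gr n m → ℝ) (L : StrongDual ℝ (Fin n → ℝ)) : ℂ :=
  ∫ g, (q g : ℂ) * horChar L g

lemma integrable_mul_of_bound {q : Gr n m → ℝ} (hq : Integrable q) {F : Gr n m → ℂ}
    (hF : Continuous F) {C : ℝ} (hC : ∀ g, ‖F g‖ ≤ C) :
    Integrable fun g => (q g : ℂ) * F g :=
  hq.ofReal.mul_bdd hF.aestronglyMeasurable (ae_of_all _ hC)

lemma horFourier_convolution (ω : (Fin n → ℝ) →ₗ[ℝ] (Fin n → ℝ) →ₗ[ℝ] (Fin m → ℝ))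
    {q₁ q₂ q₃ : Gr n m → ℝ} (h₁ : Integrable q₁) (h₂ : Integrable q₂)
    (h : ∀ g, q₃ g = ∫ g', q₁ g' * q₂ (grpMul ω (grpInv g') g))
    (L : StrongDual ℝ (Fin n → ℝ)) :
    horFourier q₃ L = horFourier q₁ L * horFourier q₂ L := by
  have hL := (contDiff_horChar (m := m) L).continuous
  set H : Gr n m × Gr n m → ℂ :=
    fun p => ((q₁ p.1 : ℂ) * horChar L p.1) * ((q₂ p.2 : ℂ) * horChar L p.2) with hH
  have hHint : Integrable H (volume.prod volume) :=
    (integrable_mul_of_bound h₁ hL fun g => (norm_horChar L g).le).mul_prod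
      (integrable_mul_of_bound h₂ hL fun g => (norm_horChar L g).le)
  have hS := measurePreserving_shear (m := m) ω
  have hHS := hS.integrable_comp_of_integrable hHint
  calc horFourier q₃ L
      = ∫ g, ∫ g', H (g', grpMul ω (grpInv g') g) := by
        unfold horFourier
        congr 1 with g
        rw [h, ← integral_complex_ofReal, ← integral_mul_const]
        congr 1 with g'
        simp only [hH]
        rw [← horChar_mul_grpMul_inv ω L g' g]
        push_cast
        ring
    _ = ∫ p, H (p.1, grpMul ω (grpInv p.1) p.2) ∂(volume.prod volume) :=
        (integral_prod_symm _ hHS).symm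
    _ = ∫ p, H p ∂(volume.prod volume) := by
        conv_rhs => rw [← hS.map_eq]
        rw [integral_map hS.aemeasurable]
        rw [hS.map_eq]
        exact hHint.aestronglyMeasurable
    _ = horFourier q₁ L * horFourier q₂ L :=
        integral_prod_mul (fun g => (q₁ g : ℂ) * horChar L g) fun g => (q₂ g : ℂ) * horChar L g

lemma Qhf_zero_of_pos (ω : (Fin n → ℝ) →ₗ[ℝ] (Fin n → ℝ) →ₗ[ℝ] (Fin m → ℝ))
    (q : ℝ → Gr n m → ℝ) {t : ℝ} (ht : 0 < t) (f : Gr n m → ℂ) :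
    Qhf ω q t f 0 = ∫ g, (q t g : ℂ) * f g := by
  rw [Qhf, if_neg ht.not_ge]
  simp [grpMul, grpInv]

lemma norm_integral_mul_cutoff_sub_le {q : Gr n m → ℝ} (hq0 : ∀ g, 0 ≤ q g)
    (hq1 : ∫ g, q g = 1) {F : Gr n m → ℂ} (hF : Continuous F) (hF1 : ∀ g, ‖F g‖ ≤ 1)
    {χ : Gr n m → ℝ} (hχ : Continuous χ) (hχ0 : ∀ g, 0 ≤ χ g) (hχ1 : ∀ g, χ g ≤ 1) :
    ‖(∫ g, (q g : ℂ) * F g) - ∫ g, (q g : ℂ) * (F g * χ g)‖ ≤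
      ‖(∫ g, (q g : ℂ) * χ g) - 1‖ := by
  have hq := integrable_of_integral_eq_one hq1
  have hn : ∀ g, ‖((χ g : ℝ) : ℂ)‖ ≤ 1 := fun g => by
    rw [norm_real, Real.norm_of_nonneg (hχ0 g)]; exact hχ1 g
  have hχc : Continuous fun g => ((χ g : ℝ) : ℂ) := by fun_prop
  have i1 := integrable_mul_of_bound hq hF hF1
  have i2 := integrable_mul_of_bound hq (F := fun g => F g * χ g) (hF.mul hχc) (C := 1) fun g => by
    rw [norm_mul]; exact mul_le_one₀ (hF1 g) (norm_nonneg _) (hn g)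
  have i3 : Integrable fun g => q g * χ g :=
    hq.mul_bdd (c := 1) hχ.aestronglyMeasurable (ae_of_all _ fun g => by
      rw [Real.norm_of_nonneg (hχ0 g)]; exact hχ1 g)
  have e : (∫ g, (q g : ℂ) * χ g) - 1 = ((-∫ g, (q g - q g * χ g) : ℝ) : ℂ) := by
    rw [integral_sub hq i3, hq1]
    push_cast
    rw [← integral_complex_ofReal]
    push_cast
    ring
  have hnn : ∀ g, 0 ≤ q g - q g * χ g := fun g => by nlinarith [hq0 g, hχ1 g]
  rw [e, norm_real, norm_neg, Real.norm_of_nonneg (integral_nonneg hnn), ← integral_sub i1 i2]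
  refine norm_integral_le_of_norm_le (hq.sub i3) (ae_of_all _ fun g => ?_)
  have : (q g : ℂ) * F g - q g * (F g * χ g) = ((q g - q g * χ g : ℝ) : ℂ) * F g := by
    push_cast; ring
  rw [this, norm_mul, norm_real, Real.norm_of_nonneg (hnn g)]
  exact mul_le_of_le_one_right (hnn g) (hF1 g)

/-- Any density family with generator `subLap` has the Gaussian infinitesimal horizontal
characteristic exponent. -/
lemma tendsto_slope_horFourier (ω : (Fin n → ℝ) →ₗ[ℝ] (Fin n → ℝ) →ₗ[ℝ] (Fin m → ℝ))
    {q : ℝ → Gr n m → ℝ}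
    (hprob : ∀ t : ℝ, 0 < t → (∀ g, 0 ≤ q t g) ∧ ∫ g : Gr n m, q t g = 1)
    (hgen : ∀ f : Gr n m → ℂ, ContDiff ℝ (⊤ : ℕ∞) f → HasCompactSupport f → ∀ g : Gr n m,
      HasDerivWithinAt (fun t : ℝ => Qhf ω q t f g) (subLap ω f g) (Set.Ici 0) 0)
    (L : StrongDual ℝ (Fin n → ℝ)) :
    Tendsto (fun s : ℝ => s⁻¹ • (horFourier (q s) L - 1)) (𝓝[>] 0)
      (𝓝 (-((∑ i, L (Pi.single i 1) ^ 2 : ℝ) : ℂ))) := by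
  let β : ContDiffBump (0 : Gr n m) := ⟨1, 2, one_pos, one_lt_two⟩
  set χ : Gr n m → ℂ := fun g => ((β g : ℝ) : ℂ)
  have hχs : ContDiff ℝ (⊤ : ℕ∞) χ := ofRealCLM.contDiff.comp β.contDiff
  have hχc : HasCompactSupport χ := β.hasCompactSupport.comp_left
    (g := fun x : ℝ => (x : ℂ)) ofReal_zero
  have hχ1 : ∀ᶠ g in 𝓝 0, χ g = 1 := by
    filter_upwards [β.eventuallyEq_one] with g hg
    simp [χ, hg]
  have key : ∀ M : StrongDual ℝ (Fin n → ℝ),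
      Tendsto (fun s : ℝ => s⁻¹ • ((∫ g, (q s g : ℂ) * (horChar M g * χ g)) - 1)) (𝓝[>] 0)
        (𝓝 (-((∑ i, M (Pi.single i 1) ^ 2 : ℝ) : ℂ))) := by
    intro M
    have h := (hgen _ ((contDiff_horChar M).mul hχs) (hχc.mul_left) 0).mono Set.Ioi_subset_Ici_self
    rw [hasDerivWithinAt_iff_tendsto_slope' Set.self_notMem_Ioi,
      subLap_horChar_mul_cutoff ω M χ hχ1] at h
    refine h.congr' ?_
    filter_upwards [self_mem_nhdsWithin] with s hs
    rw [slope_def_module, sub_zero, Qhf_zero_of_pos ω q hs]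
    congr 2
    simp [Qhf, horChar, hχ1.self_of_nhds]
  have h0 := key 0
  simp only [horChar, zero_apply, ofReal_zero, zero_mul, Complex.exp_zero,
    one_mul, ne_eq, OfNat.ofNat_ne_zero, not_false_eq_true, zero_pow, Finset.sum_const_zero,
    neg_zero] at h0
  have hdiff : Tendsto (fun s : ℝ => s⁻¹ • (horFourier (q s) L -
      ∫ g, (q s g : ℂ) * (horChar L g * χ g))) (𝓝[>] 0) (𝓝 0) := by
    refine squeeze_zero_norm' ?_ (tendsto_zero_iff_norm_tendsto_zero.1 h0)
    filter_upwards [self_mem_nhdsWithin] with s hs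
    rw [norm_smul, norm_smul]
    gcongr
    exact norm_integral_mul_cutoff_sub_le (hprob s hs).1 (hprob s hs).2
      (contDiff_horChar L).continuous (fun g => (norm_horChar L g).le) β.continuous
      (fun g => β.nonneg) (fun g => β.le_one)
  have := hdiff.add (key L)
  rw [zero_add] at this
  refine this.congr fun s => ?_
  rw [← smul_add]
  congr 1
  ring

lemma horFourier_heat (ω : (Fin n → ℝ) →ₗ[ℝ] (Fin n → ℝ) →ₗ[ℝ] (Fin m → ℝ))
    {q : ℝ → Gr n m → ℝ}
    (hprob : ∀ t : ℝ, 0 < t → (∀ g, 0 ≤ q t g) ∧ ∫ g : Gr n m, q t g = 1)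
    (hsemi : ∀ t s : ℝ, 0 < t → 0 < s → ∀ g : Gr n m,
      q (t + s) g = ∫ g' : Gr n m, q t g' * q s (grpMul ω (grpInv g') g))
    (hgen : ∀ f : Gr n m → ℂ, ContDiff ℝ (⊤ : ℕ∞) f → HasCompactSupport f → ∀ g : Gr n m,
      HasDerivWithinAt (fun t : ℝ => Qhf ω q t f g) (subLap ω f g) (Set.Ici 0) 0)
    (L : StrongDual ℝ (Fin n → ℝ)) {t : ℝ} (ht : 0 < t) :
    horFourier (q t) L = Complex.exp (-((t * ∑ i, L (Pi.single i 1) ^ 2 : ℝ) : ℂ)) := by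
  have hpow : ∀ s : ℝ, 0 < s → ∀ N : ℕ,
      horFourier (q ((N + 1 : ℕ) * s)) L = horFourier (q s) L ^ (N + 1) := by
    intro s hs N
    induction N with
    | zero => simp
    | succ N ih =>
      have hN : 0 < ((N + 1 : ℕ) : ℝ) * s := by positivity
      have e : ((N + 1 + 1 : ℕ) : ℝ) * s = (N + 1 : ℕ) * s + s := by push_cast; ring
      rw [e, pow_succ, ← ih]
      exact horFourier_convolution ω (integrable_of_integral_eq_one (hprob _ hN).2)
        (integrable_of_integral_eq_one (hprob _ hs).2) (hsemi _ _ hN hs) L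
  have hseq : Tendsto (fun N : ℕ => t / (N : ℝ)) atTop (𝓝[>] 0) := by
    refine tendsto_nhdsWithin_iff.2 ⟨tendsto_const_div_atTop_nhds_zero_nat t, ?_⟩
    filter_upwards [eventually_gt_atTop 0] with N hN
    have : (0 : ℝ) < N := by exact_mod_cast hN
    exact div_pos ht this
  have h1 := ((tendsto_slope_horFourier ω hprob hgen L).comp hseq).const_smul t
  have h2 : Tendsto (fun N : ℕ => (N : ℂ) * (horFourier (q (t / N)) L - 1)) atTop
      (𝓝 (-((t * ∑ i, L (Pi.single i 1) ^ 2 : ℝ) : ℂ))) := by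
    have e : -((t * ∑ i, L (Pi.single i 1) ^ 2 : ℝ) : ℂ)
        = t • (-((∑ i, L (Pi.single i 1) ^ 2 : ℝ) : ℂ)) := by
      rw [real_smul]; push_cast; ring
    rw [e]
    refine h1.congr fun N => ?_
    simp only [Function.comp_apply, real_smul, inv_div]
    have : (t : ℂ) ≠ 0 := by exact_mod_cast ht.ne'
    push_cast
    field_simp
  refine tendsto_nhds_unique (tendsto_const_nhds.congr' ?_)
    (Complex.tendsto_one_add_pow_exp_of_tendsto h2)
  filter_upwards [eventually_gt_atTop 0] with N hN
  obtain ⟨N, rfl⟩ := Nat.exists_eq_succ_of_ne_zero hN.ne'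
  have hN' : (0 : ℝ) < (N + 1 : ℕ) := by positivity
  rw [add_sub_cancel, ← hpow _ (div_pos ht hN'), mul_div_cancel₀ _ hN'.ne']

/-- The measure with density `q`. -/
def densityMeasure {X : Type*} [MeasureSpace X] (q : X → ℝ) : Measure X :=
  volume.withDensity fun x => ENNReal.ofReal (q x)

lemma integral_densityMeasure {X : Type*} [MeasureSpace X] {q : X → ℝ} (hq : Measurable q)
    (hq0 : ∀ x, 0 ≤ q x) (F : X → ℂ) :
    ∫ x, F x ∂(densityMeasure q) = ∫ x, (q x : ℂ) * F x := by
  rw [densityMeasure, integral_withDensity_eq_integral_toReal_smul hq.ennreal_ofReal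
    (ae_of_all _ fun _ => ENNReal.ofReal_lt_top)]
  simp [ENNReal.toReal_ofReal (hq0 _)]

lemma isFiniteMeasure_densityMeasure {X : Type*} [MeasureSpace X] {q : X → ℝ}
    (hq : Integrable q) : IsFiniteMeasure (densityMeasure q) :=
  isFiniteMeasure_withDensity_ofReal hq.2

lemma gaussDen_eq_prod (y : Fin n → ℝ) : gaussDen y = ∏ i, gaussianPDFReal 0 1 (y i) := by
  simp only [gaussDen, gaussianPDFReal, Finset.prod_mul_distrib, Finset.prod_const,
    Finset.card_univ, Fintype.card_fin, ← Real.exp_sum]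
  congr 1
  · rw [inv_pow]
    congr 1
    rw [Real.sqrt_eq_iff_mul_self_eq (by positivity) (by positivity), ← mul_pow,
      Real.mul_self_sqrt (by positivity)]
    simp
  · congr 1
    rw [neg_div, Finset.sum_div, ← Finset.sum_neg_distrib]
    refine Finset.sum_congr rfl fun i _ => ?_
    simp
    ring

lemma gaussDen_nonneg (y : Fin n → ℝ) : 0 ≤ gaussDen y := by unfold gaussDen; positivity

lemma continuous_gaussDen : Continuous (gaussDen : (Fin n → ℝ) → ℝ) := by
  unfold gaussDen; fun_prop

lemma integral_gaussDen : ∫ y : Fin n → ℝ, gaussDen y = 1 := by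
  simp_rw [gaussDen_eq_prod]
  rw [integral_fintype_prod_volume_eq_prod (f := fun _ x => gaussianPDFReal 0 1 x)]
  simp [integral_gaussianPDFReal_eq_one]

lemma integral_gaussDen_mul_exp (c : Fin n → ℝ) :
    ∫ y : Fin n → ℝ, (gaussDen y : ℂ) * Complex.exp (((∑ i, c i * y i : ℝ) : ℂ) * I)
      = Complex.exp (-((∑ i, c i ^ 2 : ℝ) : ℂ) / 2) := by
  have h : ∀ y : Fin n → ℝ,
      (gaussDen y : ℂ) * Complex.exp (((∑ i, c i * y i : ℝ) : ℂ) * I)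
        = ∏ i, ((gaussianPDFReal 0 1 (y i) : ℂ) * Complex.exp ((c i : ℂ) * (y i : ℂ) * I)) := by
    intro y
    rw [Finset.prod_mul_distrib, ← Complex.exp_sum, gaussDen_eq_prod]
    push_cast
    rw [Finset.sum_mul]
  simp_rw [h]
  rw [integral_fintype_prod_volume_eq_prod
    (f := fun i (x : ℝ) => (gaussianPDFReal 0 1 x : ℂ) * Complex.exp ((c i : ℂ) * (x : ℂ) * I))]
  have h1 : ∀ i, ∫ x : ℝ, (gaussianPDFReal 0 1 x : ℂ) * Complex.exp ((c i : ℂ) * (x : ℂ) * I)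
      = Complex.exp (-(c i : ℂ) ^ 2 / 2) := by
    intro i
    have := charFun_gaussianReal (μ := 0) (v := 1) (c i)
    rw [charFun_apply_real, integral_gaussianReal_eq_integral_smul one_ne_zero] at this
    simp only [real_smul] at this
    rw [this]
    congr 1
    simp
    ring
  simp_rw [h1]
  rw [← Complex.exp_sum]
  congr 1
  push_cast
  rw [neg_div, Finset.sum_div, ← Finset.sum_neg_distrib]
  exact Finset.sum_congr rfl fun i _ => neg_div _ _

/-- The horizontal marginal of the heat kernel is a centred Gaussian of variance `2s`. -/
lemma map_fst_heat (ω : (Fin n → ℝ) →ₗ[ℝ] (Fin n → ℝ) →ₗ[ℝ] (Fin m → ℝ))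
    {q : ℝ → Gr n m → ℝ}
    (hprob : ∀ t : ℝ, 0 < t → (∀ g, 0 ≤ q t g) ∧ ∫ g : Gr n m, q t g = 1)
    (hcont : ∀ t : ℝ, 0 < t → Continuous (q t))
    (hsemi : ∀ t s : ℝ, 0 < t → 0 < s → ∀ g : Gr n m,
      q (t + s) g = ∫ g' : Gr n m, q t g' * q s (grpMul ω (grpInv g') g))
    (hgen : ∀ f : Gr n m → ℂ, ContDiff ℝ (⊤ : ℕ∞) f → HasCompactSupport f → ∀ g : Gr n m,
      HasDerivWithinAt (fun t : ℝ => Qhf ω q t f g) (subLap ω f g) (Set.Ici 0) 0)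
    {s : ℝ} (hs : 0 < s) :
    (densityMeasure (q s)).map Prod.fst
      = (densityMeasure (gaussDen : (Fin n → ℝ) → ℝ)).map fun y => Real.sqrt (2 * s) • y := by
  have := isFiniteMeasure_densityMeasure (integrable_of_integral_eq_one (hprob s hs).2)
  have := isFiniteMeasure_densityMeasure
    (integrable_of_integral_eq_one (integral_gaussDen (n := n)))
  have hsm : Measurable fun y : Fin n → ℝ => Real.sqrt (2 * s) • y := by fun_prop
  refine Measure.ext_of_charFunDual (funext fun L => ?_)
  have hLc : Continuous fun h : Fin n → ℝ => Complex.exp ((L h : ℂ) * I) := by fun_prop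
  rw [charFunDual_apply, charFunDual_apply, integral_map measurable_fst.aemeasurable
      hLc.aestronglyMeasurable, integral_map hsm.aemeasurable hLc.aestronglyMeasurable,
    integral_densityMeasure (hcont s hs).measurable (hprob s hs).1,
    integral_densityMeasure continuous_gaussDen.measurable gaussDen_nonneg]
  have hL : ∀ y : Fin n → ℝ, L (Real.sqrt (2 * s) • y)
      = ∑ i, (Real.sqrt (2 * s) * L (Pi.single i 1)) * y i := by
    intro y
    conv_lhs => rw [← Finset.univ_sum_single y, Finset.smul_sum, map_sum]
    refine Finset.sum_congr rfl fun i _ => ?_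
    have : (Pi.single i (y i) : Fin n → ℝ) = y i • Pi.single i 1 := by
      rw [← Pi.single_smul]; simp
    rw [this, map_smul, map_smul, smul_eq_mul, smul_eq_mul]
    ring
  simp_rw [hL]
  rw [integral_gaussDen_mul_exp]
  refine (horFourier_heat ω hprob hsemi hgen L hs).trans ?_
  congr 1
  simp_rw [mul_pow, Real.sq_sqrt (by positivity : (0 : ℝ) ≤ 2 * s), ← Finset.mul_sum]
  push_cast
  ring

end Helpers

theorem stmt_11 (n m : ℕ) (hn : 0 < n) (hm : 0 < m)
    (ω : (Fin n → ℝ) →ₗ[ℝ] (Fin n → ℝ) →ₗ[ℝ] (Fin m → ℝ))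
    (hskew : ∀ x y, ω x y = - ω y x)
    (hspan : Submodule.span ℝ
      (Set.range fun p : (Fin n → ℝ) × (Fin n → ℝ) => ω p.1 p.2) = ⊤)
    -- `ψ = (σ,b,κ) ∈ 𝒩_log`:
    (σM : Matrix (Fin m) (Fin m) ℝ) (b : Fin m → ℝ) (κ : Measure (Fin m → ℝ))
    (hLevy : IsLevyTriple σM b κ) (hLog : HasLogMoment κ)
    -- the horizontal heat kernel `𝗊` of `G`:
    (qheat : ℝ → Gr n m → ℝ)
    (hqheat_prob : ∀ t : ℝ, 0 < t → (∀ g, 0 ≤ qheat t g) ∧ ∫ g : Gr n m, qheat t g = 1)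
    (hqheat_smooth : ∀ t : ℝ, 0 < t → ContDiff ℝ (⊤ : ℕ∞) (qheat t))
    (hqheat_semi : ∀ t s : ℝ, 0 < t → 0 < s → ∀ g : Gr n m,
      qheat (t + s) g = ∫ g' : Gr n m, qheat t g' * qheat s (grpMul ω (grpInv g') g))
    (hqheat_gen : ∀ f : Gr n m → ℂ, ContDiff ℝ (⊤ : ℕ∞) f → HasCompactSupport f → ∀ g : Gr n m,
      HasDerivWithinAt (fun t : ℝ => Qhf ω qheat t f g) (subLap ω f g) (Set.Ici 0) 0)
    -- the laws `μ^{ψ_t}` with characteristic function `e^{ψ_t}`: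
    (μψ : ℝ → Measure (Fin m → ℝ))
    (hμprob : ∀ t : ℝ, 0 ≤ t → IsProbabilityMeasure (μψ t))
    (hμchar : ∀ t : ℝ, 0 ≤ t → ∀ l : Fin m → ℝ,
      ∫ v, Complex.exp (Complex.I * ((dotR v l : ℝ) : ℂ)) ∂(μψ t)
        = Complex.exp (psit σM b κ t l))
    -- the invariant density `𝗉_ψ = 𝗊_{1/2} *_v μ̄_ψ` of `ℙ^ψ`:
    (μinf : Measure (Fin m → ℝ)) (hμinf_prob : IsProbabilityMeasure μinf)
    (hμinf_char : ∀ l : Fin m → ℝ,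
      ∫ v, Complex.exp (Complex.I * ((dotR v l : ℝ) : ℂ)) ∂μinf
        = Complex.exp (psiInfty σM b κ l))
    (pψ : Gr n m → ℝ)
    (hpψ : ∀ h : Fin n → ℝ, ∀ v : Fin m → ℝ, pψ (h, v) = ∫ u, qheat (1 / 2) (h, v + u) ∂μinf) :
    -- (i) `Π` is an isometry of `L^p(ℝ^n, μ̃)` into `L^p(G, 𝗉_ψ)` for every `p ≥ 1`:
    (∀ p : ℝ, 1 ≤ p → ∀ f : (Fin n → ℝ) → ℂ, Measurable f →
      ∫⁻ g : Gr n m, ENNReal.ofReal (‖f g.1‖ ^ p) * ENNReal.ofReal (pψ g)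
        = ∫⁻ h : Fin n → ℝ, ENNReal.ofReal (‖f h‖ ^ p) * ENNReal.ofReal (gaussDen h)) ∧
    -- (ii) the intertwining `ℙ^ψ_t ∘ Π = Π ∘ P̃_t`:
    (∀ t : ℝ, 0 ≤ t → ∀ f : (Fin n → ℝ) → ℂ, Continuous f →
      (∃ C : ℝ, ∀ x, ‖f x‖ ≤ C) →
      ∀ h : Fin n → ℝ, ∀ v : Fin m → ℝ,
        POUpsi ω qheat μψ t (fun g => f g.1) (h, v) = OUreal t f h) := by
  have hcont : ∀ t : ℝ, 0 < t → Continuous (qheat t) := fun t ht => (hqheat_smooth t ht).continuous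
  have hmarg := fun (s : ℝ) (hs : 0 < s) =>
    map_fst_heat ω hqheat_prob hcont hqheat_semi hqheat_gen hs
  refine ⟨fun p _ f hf => ?_, fun t ht f hf _ h v => ?_⟩
  · set F : (Fin n → ℝ) → ENNReal := fun h => ENNReal.ofReal (‖f h‖ ^ p)
    have hF : Measurable F := (hf.norm.pow_const p).ennreal_ofReal
    have hhalf : (0 : ℝ) < 1 / 2 := by norm_num
    have hq0 := (hqheat_prob _ hhalf).1
    have hqc := hcont _ hhalf
    have hm := hmarg _ hhalf
    rw [show (2 * (1 / 2) : ℝ) = 1 by norm_num, Real.sqrt_one] at hm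
    simp only [one_smul, Measure.map_id'] at hm
    let T : (Fin m → ℝ) → Gr n m → Gr n m := fun u g => (g.1, g.2 + u)
    have hT : ∀ u, MeasurePreserving (T u) volume volume := fun u =>
      (MeasurePreserving.id volume).prod (measurePreserving_add_right volume u)
    have hTc : Continuous fun p : Gr n m × (Fin m → ℝ) => qheat (1 / 2) (T p.2 p.1) :=
      hqc.comp (by fun_prop)
    have hmass : ∀ G : (Fin n → ℝ) → ENNReal, Measurable G →
        ∫⁻ g : Gr n m, ∫⁻ u, G g.1 * ENNReal.ofReal (qheat (1 / 2) (T u g)) ∂μinf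
          = ∫⁻ h, G h * ENNReal.ofReal (gaussDen h) := by
      intro G hG
      rw [lintegral_lintegral_swap (by
        exact ((hG.comp (measurable_fst.comp measurable_fst)).mul
          hTc.measurable.ennreal_ofReal).aemeasurable)]
      have hu : ∀ u, ∫⁻ g : Gr n m, G g.1 * ENNReal.ofReal (qheat (1 / 2) (T u g))
          = ∫⁻ h, G h * ENNReal.ofReal (gaussDen h) := by
        intro u
        rw [(hT u).lintegral_comp
          (f := fun g : Gr n m => G g.1 * ENNReal.ofReal (qheat (1 / 2) g))
          ((hG.comp measurable_fst).mul hqc.measurable.ennreal_ofReal)]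
        have h1 := congrArg (fun μ => ∫⁻ h, G h ∂μ) hm
        simp only [densityMeasure] at h1
        rw [lintegral_map hG measurable_fst,
          lintegral_withDensity_eq_lintegral_mul _ hqc.measurable.ennreal_ofReal
            (show Measurable fun g : Gr n m => G g.1 from hG.comp measurable_fst),
          lintegral_withDensity_eq_lintegral_mul _ continuous_gaussDen.measurable.ennreal_ofReal
            hG] at h1
        simp only [Pi.mul_apply, mul_comm (ENNReal.ofReal _)] at h1
        exact h1
      simp only [hu, lintegral_const, measure_univ, mul_one]
    have hfin : ∀ᵐ g : Gr n m, ∫⁻ u, ENNReal.ofReal (qheat (1 / 2) (T u g)) ∂μinf < ⊤ := by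
      refine ae_lt_top (hTc.measurable.ennreal_ofReal.lintegral_prod_right') ?_
      have h1 := hmass (fun _ => 1) measurable_const
      simp only [one_mul] at h1
      rw [h1, ← ofReal_integral_eq_lintegral_ofReal
        (integrable_of_integral_eq_one integral_gaussDen) (ae_of_all _ gaussDen_nonneg)]
      exact ENNReal.ofReal_ne_top
    rw [← hmass F hF]
    refine lintegral_congr_ae ?_
    filter_upwards [hfin] with g hg
    have hgm : Measurable fun u => qheat (1 / 2) (T u g) :=
      (hqc.comp (by fun_prop : Continuous fun u => T u g)).measurable
    rw [lintegral_const_mul _ hgm.ennreal_ofReal]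
    congr 1
    have hpg : pψ g = ∫ u, qheat (1 / 2) (T u g) ∂μinf := hpψ g.1 g.2
    rw [hpg, ofReal_integral_eq_lintegral_ofReal _ (ae_of_all _ fun u => hq0 _)]
    refine ⟨hgm.aestronglyMeasurable, ?_⟩
    rw [hasFiniteIntegral_iff_ofReal (ae_of_all _ fun u => hq0 _)]
    exact hg
  · have := hμprob t ht
    rcases ht.eq_or_lt with rfl | ht
    · have h1 : ∫ y : Fin n → ℝ, ((gaussDen y : ℝ) : ℂ) = 1 := by
        rw [integral_complex_ofReal, integral_gaussDen, ofReal_one]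
      simp [POUpsi, OUreal, Qhf, dil, integral_const_mul, h1]
    · set s := (1 - Real.exp (-(2 * t))) / 2 with hs_def
      have hs : 0 < s := by
        have : Real.exp (-(2 * t)) < 1 := (Real.exp_lt_exp.2 (by linarith)).trans_eq Real.exp_zero
        rw [hs_def]; linarith
      have hs2 : 1 - Real.exp (-(2 * t)) = 2 * s := by rw [hs_def]; ring
      have hq0 := (hqheat_prob s hs).1
      have hQ : ∀ g : Gr n m, Qhf ω qheat s (fun g => f g.1) g
          = ∫ y : Fin n → ℝ, f (g.1 + Real.sqrt (2 * s) • y) * ((gaussDen y : ℝ) : ℂ) := by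
        intro g
        have hfc : Continuous fun y => f (g.1 + y) := by fun_prop
        have hT := measurePreserving_grpMul ω (grpInv g)
        have hcomp := integral_map (μ := (volume : Measure (Gr n m))) hT.aemeasurable
          (f := fun x : Gr n m => (qheat s x : ℂ) * f (g.1 + x.1))
          (by
            have := hcont s hs
            exact Continuous.aestronglyMeasurable (by fun_prop))
        rw [hT.map_eq] at hcomp
        have e := congrArg (fun μ => ∫ y, f (g.1 + y) ∂μ) (hmarg s hs)
        rw [integral_map measurable_fst.aemeasurable hfc.aestronglyMeasurable,
          integral_map (by fun_prop) hfc.aestronglyMeasurable,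
          integral_densityMeasure (hcont s hs).measurable hq0,
          integral_densityMeasure continuous_gaussDen.measurable gaussDen_nonneg, hcomp] at e
        rw [Qhf, if_neg hs.not_ge]
        simp_rw [mul_comm (f _)]
        rw [← e]
        simp [grpMul, grpInv]
      rw [POUpsi, OUreal, ← hs_def, hs2]
      simp_rw [hQ, dil]
      simp only [integral_const, probReal_univ, one_smul]

end
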